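/- arXiv:1710.02407 — 7 statements merged into one kernel-verified Lean document; each statement's English description precedes it below -/
import Mathlib

section
/- For every y ∈ V with y ≠ 0 and ⟨X,y⟩ ≠ 0, and every u ∈ V, the fundamental tensor of the Kropina function satisfies the identity g_y(u, y) = (F(y)³ / ⟨y,y⟩) · ⟨u, (2/F(y))·y − X⟩. -/
open RealInnerProductSpace
open scoped Topology

/-- If `G` satisfies Euler's identity for functions homogeneous of degree two near `y`, then
`D²G(y)[u, y] = DG(y)[u]`. -/
theorem fderiv_fderiv_apply_self_of_euler
    {E : Type*} [NormedAddCommGroup E] [NormedSpace ℝ E] {G : E → ℝ} {y : E}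
    (hG : ContDiffAt ℝ 2 G y) (euler : ∀ᶠ z in 𝓝 y, fderiv ℝ G z z = 2 * G z) (u : E) :
    fderiv ℝ (fderiv ℝ G) y u y = fderiv ℝ G y u := by
  have h₁ : DifferentiableAt ℝ G y := hG.differentiableAt (by norm_num)
  have h₂ : DifferentiableAt ℝ (fderiv ℝ G) y :=
    (hG.fderiv_right (m := 1) (by norm_num)).differentiableAt (by norm_num)
  have hl := h₂.hasFDerivAt.clm_apply (hasFDerivAt_id y)
  have hr := h₁.hasFDerivAt.const_mul 2
  have h := DFunLike.congr_fun (hl.unique (hr.congr_of_eventuallyEq euler)) u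
  simp at h
  linarith

/-- The derivative of the square of the Kropina function. -/
theorem fderiv_sq_kropina
    {V : Type*} [NormedAddCommGroup V] [InnerProductSpace ℝ V] {X z : V}
    (hz : ⟪X, z⟫ ≠ 0) (v : V) :
    fderiv ℝ (fun w : V => (⟪w, w⟫ / ⟪X, w⟫) ^ 2) z v
      = 4 * ⟪z, z⟫ * ⟪z, v⟫ / ⟪X, z⟫ ^ 2 - 2 * ⟪z, z⟫ ^ 2 * ⟪X, v⟫ / ⟪X, z⟫ ^ 3 := by
  have ha := (hasFDerivAt_id z).inner ℝ (hasFDerivAt_id z)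
  have hb := (hasFDerivAt_const X z).inner ℝ (hasFDerivAt_id z)
  have hinv := (hasDerivAt_inv hz).comp_hasFDerivAt z hb
  have h : HasFDerivAt (fun w : V => (⟪w, w⟫ / ⟪X, w⟫) ^ 2) _ z := (ha.mul hinv).pow 2
  rw [h.fderiv]
  simp [real_inner_comm z v]
  field_simp
  ring

/-- For every `y ≠ 0` with `⟪X, y⟫ ≠ 0` and every `u`, the fundamental
tensor of the Kropina function `F y = ⟪y, y⟫ / ⟪X, y⟫` satisfies
`g_y(u, y) = (F(y)³ / ⟪y,y⟫) · ⟪u, (2/F(y))·y − X⟫`, where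
`g_y(u, v) = (1/2)·D²(F²)(y)[u, v]`. -/
theorem kropina_fundamental_tensor_identity
    {V : Type*} [NormedAddCommGroup V] [InnerProductSpace ℝ V] [FiniteDimensional ℝ V]
    (X : V) (F : V → ℝ)
    (hF : ∀ y : V, ⟪X, y⟫ ≠ 0 → F y = ⟪y, y⟫ / ⟪X, y⟫)
    (y : V) (hy : y ≠ 0) (hXy : ⟪X, y⟫ ≠ 0) (u : V) :
    (1 / 2 : ℝ) * fderiv ℝ (fun z => fderiv ℝ (fun w => F w ^ 2) z) y u y
      = (F y) ^ 3 / ⟪y, y⟫ * ⟪u, (2 / F y) • y - X⟫ := by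
  have hne : ∀ᶠ z in 𝓝 y, ⟪X, z⟫ ≠ 0 :=
    ContinuousAt.eventually_ne (by fun_prop) hXy
  have hFG : (fun w => F w ^ 2) =ᶠ[𝓝 y] fun w => (⟪w, w⟫ / ⟪X, w⟫) ^ 2 := by
    filter_upwards [hne] with z hz
    rw [hF z hz]
  have hG : ContDiffAt ℝ 2 (fun w : V => (⟪w, w⟫ / ⟪X, w⟫) ^ 2) y :=
    ((contDiffAt_id.inner ℝ contDiffAt_id).div (contDiffAt_const.inner ℝ contDiffAt_id) hXy).pow 2
  have euler : ∀ᶠ z in 𝓝 y, fderiv ℝ (fun w : V => (⟪w, w⟫ / ⟪X, w⟫) ^ 2) z z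
      = 2 * (⟪z, z⟫ / ⟪X, z⟫) ^ 2 := by
    filter_upwards [hne] with z hz
    rw [fderiv_sq_kropina hz]
    field_simp
    ring
  have hyy : ⟪y, y⟫ ≠ 0 := inner_self_ne_zero.mpr hy
  rw [hFG.fderiv.fderiv_eq, fderiv_fderiv_apply_self_of_euler hG euler, fderiv_sq_kropina hXy,
    hF y hXy, inner_sub_right, inner_smul_right, real_inner_comm y u, real_inner_comm X u]
  field_simp
  ring
end

section
/- Let Y ∈ 𝔤 be such that Y_𝔪 ≠ 0 and ⟨X, Y_𝔪⟩ ≠ 0. Then g_{Y_𝔪}([Y,Z]_𝔪, Y_𝔪) = 0 for every Z ∈ 𝔪 if and only if ⟨[Y,Z]_𝔪, (2/F(Y_𝔪))·Y_𝔪 − X⟩ = 0 for every Z ∈ 𝔪. -/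
open RealInnerProductSpace

/-- The quotient rule for real-valued functions on a normed space. -/
theorem hasFDerivAt_div_real {E : Type*} [NormedAddCommGroup E] [NormedSpace ℝ E]
    {f g : E → ℝ} {f' g' : E →L[ℝ] ℝ} {x : E} (hf : HasFDerivAt f f' x)
    (hg : HasFDerivAt g g' x) (hx : g x ≠ 0) :
    HasFDerivAt (fun y => f y / g y) ((g x)⁻¹ • f' - (f x / g x ^ 2) • g') x := by
  have h := hf.mul ((hasDerivAt_inv hx).comp_hasFDerivAt x hg)
  refine h.congr_fderiv ?_
  ext u
  simp
  field_simp
  ring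

/-- The differential of the squared Kropina function `⟪z, z⟫ ^ 2 / ⟪X, z⟫ ^ 2`. -/
theorem hasFDerivAt_kropina_sq {G : Type*} [NormedAddCommGroup G] [InnerProductSpace ℝ G]
    {X z : G} (hz : ⟪X, z⟫ ≠ 0) :
    HasFDerivAt (fun w : G => (⟪w, w⟫ / ⟪X, w⟫ : ℝ) ^ 2)
      ((4 * ⟪z, z⟫ / ⟪X, z⟫ ^ 2 : ℝ) • innerSL ℝ z -
        (2 * ⟪z, z⟫ ^ 2 / ⟪X, z⟫ ^ 3 : ℝ) • innerSL ℝ X) z := by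
  have hq : HasFDerivAt (fun w : G => (⟪w, w⟫ : ℝ)) (2 • innerSL ℝ z) z := by
    simpa only [real_inner_self_eq_norm_sq] using (hasStrictFDerivAt_norm_sq z).hasFDerivAt
  have hl : HasFDerivAt (fun w : G => (⟪X, w⟫ : ℝ)) (innerSL ℝ X) z :=
    (innerSL ℝ X).hasFDerivAt
  refine ((hasFDerivAt_div_real hq hl hz).pow 2).congr_fderiv ?_
  ext u
  simp
  field_simp
  ring

/-- The Hessian of the squared Kropina function, contracted with its base point in the second
slot. -/
theorem fderiv_fderiv_kropina_sq_apply_self {G : Type*} [NormedAddCommGroup G]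
    [InnerProductSpace ℝ G] {X y : G} (hy : ⟪X, y⟫ ≠ 0) (F : G → ℝ)
    (hF : ∀ z : G, ⟪X, z⟫ ≠ 0 → F z = ⟪z, z⟫ / ⟪X, z⟫) (u : G) :
    fderiv ℝ (fun z => fderiv ℝ (fun w => F w ^ 2) z) y u y =
      4 * ⟪y, y⟫ / ⟪X, y⟫ ^ 2 * ⟪y, u⟫ - 2 * ⟪y, y⟫ ^ 2 / ⟪X, y⟫ ^ 3 * ⟪X, u⟫ := by
  obtain ⟨B, hB⟩ : ∃ B : G →L[ℝ] G →L[ℝ] ℝ, ∀ a b, B a b = ⟪a, b⟫ :=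
    ⟨innerSL ℝ, fun _ _ => rfl⟩
  have hBz : ∀ z, innerSL ℝ z = B z := fun z => by
    ext
    simp [hB]
  have hopen : IsOpen {z : G | (⟪X, z⟫ : ℝ) ≠ 0} :=
    isOpen_ne_fun (by fun_prop) continuous_const
  have hev : (fun z => fderiv ℝ (fun w => F w ^ 2) z) =ᶠ[nhds y] fun z =>
      (4 * ⟪z, z⟫ / ⟪X, z⟫ ^ 2 : ℝ) • B z -
        (2 * ⟪z, z⟫ ^ 2 / ⟪X, z⟫ ^ 3 : ℝ) • B X := by
    filter_upwards [hopen.mem_nhds hy] with z hz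
    rw [← hBz, ← hBz]
    refine ((hasFDerivAt_kropina_sq hz).congr_of_eventuallyEq ?_).fderiv
    filter_upwards [hopen.mem_nhds hz] with w hw
    rw [hF w hw]
  have hq : HasFDerivAt (fun w : G => (⟪w, w⟫ : ℝ)) (2 • innerSL ℝ y) y := by
    simpa only [real_inner_self_eq_norm_sq] using (hasStrictFDerivAt_norm_sq y).hasFDerivAt
  have hl : HasFDerivAt (fun w : G => (⟪X, w⟫ : ℝ)) (innerSL ℝ X) y :=
    (innerSL ℝ X).hasFDerivAt
  have hA := ((hasFDerivAt_div_real (hq.const_mul 4) (hl.pow 2) (pow_ne_zero 2 hy)).fun_smul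
    B.hasFDerivAt).fun_sub
      ((hasFDerivAt_div_real ((hq.pow 2).const_mul 2) (hl.pow 3) (pow_ne_zero 3 hy)).smul_const
        (B X))
  rw [hev.fderiv_eq, hA.fderiv]
  simp [hB, real_inner_comm y u]
  field_simp
  ring

/-- In a homogeneous Kropina setting (`𝔤 = 𝔪 ⊕ 𝔥`, projection `π` onto `𝔪`
along `𝔥`, inner product on `𝔪`, fixed nonzero `X ∈ 𝔪`, Kropina function
`F y = ⟪y, y⟫ / ⟪X, y⟫`), for `Y ∈ 𝔤` with `Y_𝔪 ≠ 0` and `⟪X, Y_𝔪⟫ ≠ 0`: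
`g_{Y_𝔪}([Y,Z]_𝔪, Y_𝔪) = 0` for all `Z ∈ 𝔪` iff
`⟪[Y,Z]_𝔪, (2/F(Y_𝔪))·Y_𝔪 − X⟫ = 0` for all `Z ∈ 𝔪`. -/
theorem kropina_geodesic_vector_criterion
    {G : Type*} [NormedAddCommGroup G] [InnerProductSpace ℝ G] [FiniteDimensional ℝ G]
    (bracket : G →ₗ[ℝ] G →ₗ[ℝ] G)
    (hanti : ∀ x : G, bracket x x = 0)
    (hjacobi : ∀ x y z : G,
      bracket x (bracket y z) + bracket y (bracket z x) + bracket z (bracket x y) = 0)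
    (H m : Submodule ℝ G)
    (hHsub : ∀ x ∈ H, ∀ y ∈ H, bracket x y ∈ H)
    (hcompl : IsCompl m H)
    (π : G →ₗ[ℝ] G) (hπm : ∀ w : G, π w ∈ m) (hπH : ∀ w : G, w - π w ∈ H)
    (X : G) (hXm : X ∈ m) (hX0 : X ≠ 0)
    (F : G → ℝ) (hF : ∀ y : G, ⟪X, y⟫ ≠ 0 → F y = ⟪y, y⟫ / ⟪X, y⟫)
    (Y : G) (hYm : π Y ≠ 0) (hXY : ⟪X, π Y⟫ ≠ 0) :
    (∀ Z ∈ m, (1 / 2 : ℝ) *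
        fderiv ℝ (fun z => fderiv ℝ (fun w => F w ^ 2) z) (π Y) (π (bracket Y Z)) (π Y) = 0)
      ↔ (∀ Z ∈ m, ⟪π (bracket Y Z), (2 / F (π Y)) • (π Y) - X⟫ = 0) := by
  have hq : (⟪π Y, π Y⟫ : ℝ) ≠ 0 := inner_self_ne_zero.mpr hYm
  refine forall₂_congr fun Z _ => ?_
  rw [fderiv_fderiv_kropina_sq_apply_self hXY F hF, hF _ hXY, inner_sub_right,
    real_inner_smul_right, real_inner_comm (π Y) (π (bracket Y Z)),
    real_inner_comm X (π (bracket Y Z))]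
  have hfactor : ∀ a b q l : ℝ, q ≠ 0 → l ≠ 0 →
      (1 / 2 : ℝ) * (4 * q / l ^ 2 * a - 2 * q ^ 2 / l ^ 3 * b) =
        q ^ 2 / l ^ 3 * (2 / (q / l) * a - b) := by
    intro a b q l hq hl
    field_simp
    ring
  rw [hfactor _ _ _ _ hq hXY, mul_eq_zero, or_iff_right]
  exact div_ne_zero (pow_ne_zero 2 hq) (pow_ne_zero 3 hXY)
end

section
/- Assume ⟨X, [Y,Z]_𝔪⟩ = 0 for every Y ∈ 𝔤 and Z ∈ 𝔪 (the Douglas-type condition). Then for every Y ∈ 𝔤 with Y_𝔪 ≠ 0 and ⟨X, Y_𝔪⟩ ≠ 0, one has g_{Y_𝔪}([Y,Z]_𝔪, Y_𝔪) = 0 for all Z ∈ 𝔪 if and only if ⟨[Y,Z]_𝔪, Y_𝔪⟩ = 0 for all Z ∈ 𝔪. (A nonzero vector is a geodesic vector of the Kropina metric of Douglas type if and only if it is a geodesic vector of the underlying Riemannian metric.) -/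
open RealInnerProductSpace

section Kropina

variable {G : Type*} [NormedAddCommGroup G] [InnerProductSpace ℝ G]

/-- The square of the Kropina function `⟪y, y⟫ / ⟪X, y⟫` is smooth where `⟪X, y⟫ ≠ 0`. -/
lemma contDiffAt_kropina_sq (X : G) {y : G} (hy : ⟪X, y⟫ ≠ 0) :
    ContDiffAt ℝ 2 (fun w : G => (⟪w, w⟫ / ⟪X, w⟫) ^ 2) y := by
  have h₁ : ContDiffAt ℝ 2 (fun w : G => ⟪w, w⟫) y := contDiffAt_id.inner ℝ contDiffAt_id
  have h₂ : ContDiffAt ℝ 2 (fun w : G => ⟪X, w⟫) y := contDiffAt_const.inner ℝ contDiffAt_id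
  exact (h₁.div h₂ hy).pow 2

lemma hasDerivAt_inner_line (X y u : G) :
    HasDerivAt (fun t : ℝ => ⟪X, y + t • u⟫) ⟪X, u⟫ 0 := by
  simpa [inner_add_right, inner_smul_right] using
    ((hasDerivAt_id (0 : ℝ)).mul_const ⟪X, u⟫).const_add ⟪X, y⟫

lemma hasDerivAt_inner_self_line (y u : G) :
    HasDerivAt (fun t : ℝ => ⟪y + t • u, y + t • u⟫) (2 * ⟪y, u⟫) 0 := by
  have h : HasDerivAt (fun t : ℝ => y + t • u) u 0 := by
    simpa using ((hasDerivAt_id (0 : ℝ)).smul_const u).const_add y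
  have h' := h.inner ℝ h
  simp only [zero_smul, add_zero, real_inner_comm y u] at h'
  rwa [two_mul]

/-- The first derivative of the squared Kropina function. -/
lemma fderiv_kropina_sq (X : G) {y : G} (hy : ⟪X, y⟫ ≠ 0) (v : G) :
    fderiv ℝ (fun w : G => (⟪w, w⟫ / ⟪X, w⟫) ^ 2) y v =
      4 * ⟪y, y⟫ * ⟪v, y⟫ / ⟪X, y⟫ ^ 2 - 2 * ⟪y, y⟫ ^ 2 * ⟪X, v⟫ / ⟪X, y⟫ ^ 3 := by
  rw [← ((contDiffAt_kropina_sq X hy).differentiableAt (by norm_num)).lineDeriv_eq_fderiv]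
  have h := ((hasDerivAt_inner_self_line y v).div (hasDerivAt_inner_line X y v)
    (by simpa using hy)).pow 2
  refine h.deriv.trans ?_
  simp only [Pi.div_apply, zero_smul, add_zero, real_inner_comm y v, Nat.cast_ofNat, Nat.reduceSub,
    pow_one]
  field_simp
  ring

/-- The Hessian of the squared Kropina function at `y`, evaluated on `y` and a vector orthogonal
to `X`. -/
lemma fderiv_fderiv_kropina_sq (X : G) {y : G} (hy : ⟪X, y⟫ ≠ 0) {u : G} (hu : ⟪X, u⟫ = 0) :
    fderiv ℝ (fderiv ℝ (fun w : G => (⟪w, w⟫ / ⟪X, w⟫) ^ 2)) y u y =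
      4 * ⟪y, y⟫ * ⟪u, y⟫ / ⟪X, y⟫ ^ 2 := by
  have hd : DifferentiableAt ℝ (fderiv ℝ (fun w : G => (⟪w, w⟫ / ⟪X, w⟫) ^ 2)) y :=
    ((contDiffAt_kropina_sq X hy).fderiv_right (m := 1) (by norm_num)).differentiableAt
      (by norm_num)
  have hline : HasDerivAt (fun t : ℝ => fderiv ℝ (fun w : G => (⟪w, w⟫ / ⟪X, w⟫) ^ 2)
      (y + t • u) y) (fderiv ℝ (fderiv ℝ (fun w : G => (⟪w, w⟫ / ⟪X, w⟫) ^ 2)) y u y) 0 := by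
    have h : HasDerivAt (fun t : ℝ => fderiv ℝ (fun w : G => (⟪w, w⟫ / ⟪X, w⟫) ^ 2) (y + t • u))
      (fderiv ℝ (fderiv ℝ (fun w : G => (⟪w, w⟫ / ⟪X, w⟫) ^ 2)) y u) 0 :=
      hd.hasFDerivAt.hasLineDerivAt u
    simpa using h.clm_apply (hasDerivAt_const (0 : ℝ) y)
  have hX : ∀ t : ℝ, ⟪X, y + t • u⟫ = ⟪X, y⟫ := fun t => by
    simp [inner_add_right, inner_smul_right, hu]
  have hformula : (fun t : ℝ => fderiv ℝ (fun w : G => (⟪w, w⟫ / ⟪X, w⟫) ^ 2) (y + t • u) y) =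
      fun t : ℝ => 4 * ⟪y + t • u, y + t • u⟫ * ⟪y, y + t • u⟫ / ⟪X, y⟫ ^ 2 -
        2 * ⟪y + t • u, y + t • u⟫ ^ 2 * ⟪X, y⟫ / ⟪X, y⟫ ^ 3 := by
    funext t
    rw [fderiv_kropina_sq X (by rwa [hX]), hX]
  rw [hformula] at hline
  have ha := hasDerivAt_inner_self_line y u
  have hb := hasDerivAt_inner_line y y u
  have h := (((ha.const_mul 4).mul hb).div_const (⟪X, y⟫ ^ 2)).sub
    ((((ha.pow 2).const_mul 2).mul_const ⟪X, y⟫).div_const (⟪X, y⟫ ^ 3))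
  refine (hline.unique h).trans ?_
  simp only [zero_smul, add_zero, real_inner_comm y u]
  field_simp
  push_cast
  ring

end Kropina

/-- Assume the Douglas-type condition `⟪X, [Y,Z]_𝔪⟫ = 0` for all `Y ∈ 𝔤`,
`Z ∈ 𝔪`. Then for every `Y ∈ 𝔤` with `Y_𝔪 ≠ 0` and `⟪X, Y_𝔪⟫ ≠ 0`,
`g_{Y_𝔪}([Y,Z]_𝔪, Y_𝔪) = 0` for all `Z ∈ 𝔪` iff `⟪[Y,Z]_𝔪, Y_𝔪⟫ = 0` for all `Z ∈ 𝔪`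
(geodesic vector of the Douglas-type Kropina metric iff geodesic vector of the
underlying Riemannian metric). -/
theorem kropina_douglas_geodesic_iff_riemannian
    {G : Type*} [NormedAddCommGroup G] [InnerProductSpace ℝ G] [FiniteDimensional ℝ G]
    (bracket : G →ₗ[ℝ] G →ₗ[ℝ] G)
    (hanti : ∀ x : G, bracket x x = 0)
    (hjacobi : ∀ x y z : G,
      bracket x (bracket y z) + bracket y (bracket z x) + bracket z (bracket x y) = 0)
    (H m : Submodule ℝ G)
    (hHsub : ∀ x ∈ H, ∀ y ∈ H, bracket x y ∈ H)
    (hcompl : IsCompl m H)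
    (π : G →ₗ[ℝ] G) (hπm : ∀ w : G, π w ∈ m) (hπH : ∀ w : G, w - π w ∈ H)
    (X : G) (hXm : X ∈ m) (hX0 : X ≠ 0)
    (F : G → ℝ) (hF : ∀ y : G, ⟪X, y⟫ ≠ 0 → F y = ⟪y, y⟫ / ⟪X, y⟫)
    (hDouglas : ∀ (Y : G), ∀ Z ∈ m, ⟪X, π (bracket Y Z)⟫ = 0)
    (Y : G) (hYm : π Y ≠ 0) (hXY : ⟪X, π Y⟫ ≠ 0) :
    (∀ Z ∈ m, (1 / 2 : ℝ) *
        fderiv ℝ (fun z => fderiv ℝ (fun w => F w ^ 2) z) (π Y) (π (bracket Y Z)) (π Y) = 0)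
      ↔ (∀ Z ∈ m, ⟪π (bracket Y Z), π Y⟫ = 0) := by
  have hF2 : (fun w => F w ^ 2) =ᶠ[nhds (π Y)] fun w => (⟪w, w⟫ / ⟪X, w⟫) ^ 2 := by
    have hcont : Continuous fun w : G => ⟪X, w⟫ := by fun_prop
    filter_upwards [hcont.continuousAt.eventually_ne hXY] with w hw
    rw [hF w hw]
  refine forall₂_congr fun Z hZ => ?_
  rw [hF2.fderiv.fderiv_eq, fderiv_fderiv_kropina_sq X hXY (hDouglas Y Z hZ)]
  simp [hXY, hYm]
end

section
/- Suppose the linear span of {[Y,Z]_𝔪 : Y, Z ∈ 𝔤} is a proper subspace of 𝔪. Then there exists W ∈ 𝔪 with ⟨X,W⟩ ≠ 0 and F(W) = 1 such that ⟨[W,Z]_𝔪, (2/F(W))·W − X⟩ = 0 for every Z ∈ 𝔪; that is, W is a geodesic vector of the Kropina metric. -/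
open RealInnerProductSpace

/-- A subspace properly contained in `m` admits a vector of `m` of any prescribed norm that is
orthogonal to it. -/
theorem exists_mem_orthogonal_norm_eq {E : Type*} [NormedAddCommGroup E] [InnerProductSpace ℝ E]
    {U m : Submodule ℝ E} [U.HasOrthogonalProjection] (h : U < m) {r : ℝ} (hr : 0 ≤ r) :
    ∃ v ∈ m, v ∈ Uᗮ ∧ ‖v‖ = r := by
  have hne : Uᗮ ⊓ m ≠ ⊥ := fun hbot => h.ne (by
    simpa [hbot] using Submodule.sup_orthogonal_inf_of_hasOrthogonalProjection h.le)
  obtain ⟨v, hv, hv0⟩ := Submodule.exists_mem_ne_zero_of_ne_bot hne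
  refine ⟨(r / ‖v‖) • v, m.smul_mem _ hv.2, Uᗮ.smul_mem _ hv.1, ?_⟩
  rw [norm_smul, norm_div, norm_norm, div_mul_cancel₀ _ (norm_ne_zero_iff.mpr hv0),
    Real.norm_of_nonneg hr]

/-- If the linear span of `{[Y,Z]_𝔪 : Y, Z ∈ 𝔤}` is a proper subspace of
`𝔪`, then there exists `W ∈ 𝔪` with `⟪X, W⟫ ≠ 0` and `F(W) = 1` such that
`⟪[W,Z]_𝔪, (2/F(W))·W − X⟫ = 0` for every `Z ∈ 𝔪`; i.e. `W` is a geodesic vector of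
the Kropina metric. -/
theorem kropina_geodesic_vector_exists_of_proper_span
    {G : Type*} [NormedAddCommGroup G] [InnerProductSpace ℝ G] [FiniteDimensional ℝ G]
    (bracket : G →ₗ[ℝ] G →ₗ[ℝ] G)
    (hanti : ∀ x : G, bracket x x = 0)
    (hjacobi : ∀ x y z : G,
      bracket x (bracket y z) + bracket y (bracket z x) + bracket z (bracket x y) = 0)
    (H m : Submodule ℝ G)
    (hHsub : ∀ x ∈ H, ∀ y ∈ H, bracket x y ∈ H)
    (hcompl : IsCompl m H)
    (π : G →ₗ[ℝ] G) (hπm : ∀ w : G, π w ∈ m) (hπH : ∀ w : G, w - π w ∈ H)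
    (X : G) (hXm : X ∈ m) (hX0 : X ≠ 0)
    (F : G → ℝ) (hF : ∀ y : G, ⟪X, y⟫ ≠ 0 → F y = ⟪y, y⟫ / ⟪X, y⟫)
    (hspan : Submodule.span ℝ {w : G | ∃ Y Z : G, w = π (bracket Y Z)} < m) :
    ∃ W : G, W ∈ m ∧ ⟪X, W⟫ ≠ 0 ∧ F W = 1 ∧
      ∀ Z ∈ m, ⟪π (bracket W Z), (2 / F W) • W - X⟫ = 0 := by
  obtain ⟨v, hvm, hvU, hv, hvX⟩ : ∃ v ∈ m, v ∈ (Submodule.span ℝ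
      {w : G | ∃ Y Z : G, w = π (bracket Y Z)})ᗮ ∧ ‖v‖ = ‖X‖ ∧ X + v ≠ 0 := by
    obtain ⟨v, hvm, hvU, hv⟩ := exists_mem_orthogonal_norm_eq hspan (norm_nonneg X)
    by_cases h : X + v = 0
    · refine ⟨-v, m.neg_mem hvm, Submodule.neg_mem _ hvU, by rw [norm_neg, hv], ?_⟩
      rw [← eq_neg_of_add_eq_zero_left h, ← two_smul ℝ]
      exact smul_ne_zero two_ne_zero hX0
    · exact ⟨v, hvm, hvU, hv, h⟩
  set W : G := (2⁻¹ : ℝ) • (X + v) with hW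
  have hW0 : W ≠ 0 := smul_ne_zero (by norm_num) hvX
  have hWW : ⟪W, W⟫ = ⟪X, W⟫ := by
    have hnorm : ⟪v, v⟫ = ⟪X, X⟫ := by simp only [real_inner_self_eq_norm_sq, hv]
    simp only [hW, inner_smul_left, inner_smul_right, inner_add_left, inner_add_right, hnorm,
      real_inner_comm X v, conj_trivial]
    ring
  have hXW : ⟪X, W⟫ ≠ 0 := hWW ▸ inner_self_ne_zero.mpr hW0
  have hFW : F W = 1 := by rw [hF W hXW, hWW, div_self hXW]
  refine ⟨W, m.smul_mem _ (m.add_mem hXm hvm), hXW, hFW, fun Z _ => ?_⟩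
  have hv' : (2 / F W) • W - X = v := by
    rw [hFW, hW, smul_smul]
    norm_num
  rw [hv']
  exact (Submodule.mem_orthogonal _ _).mp hvU _ (Submodule.subset_span ⟨W, Z, rfl⟩)
end

section
/- Let X₀ ∈ V, let f₁, …, f_r ∈ V be orthonormal vectors each orthogonal to X₀, let x₁, …, x_r ∈ ℝ with x₁ ≠ 0, and let λ₁, …, λ_r be nonzero reals with |λ₁| ≥ |λ_i| for all i. Set X = X₀ + Σᵢ xᵢ fᵢ and, for t ∈ (−1/|λ₁|, 1/|λ₁|), set Y(t) = X₀ + Σᵢ (xᵢ/(1 − tλᵢ)) fᵢ. Then ⟨X, Y(t)⟩ > 0 for every t in this interval, and there exists t₀ strictly between 0 and 1/λ₁ such that ⟨Y(t₀), Y(t₀)⟩ = 2·⟨X, Y(t₀)⟩, i.e. F(Y(t₀)) = 2. -/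
open RealInnerProductSpace

theorem Orthonormal.inner_add_sum_smul_add_sum_smul {V ι : Type*} [NormedAddCommGroup V]
    [InnerProductSpace ℝ V] [Fintype ι] {f : ι → V} (hf : Orthonormal ℝ f) {v : V}
    (hv : ∀ i, ⟪v, f i⟫ = 0) (a b : ι → ℝ) :
    ⟪v + ∑ i, a i • f i, v + ∑ i, b i • f i⟫ = ⟪v, v⟫ + ∑ i, a i * b i := by
  have hv' (i : ι) : ⟪f i, v⟫ = 0 := by rw [real_inner_comm, hv]
  rw [inner_add_left, inner_add_right, inner_add_right, hf.inner_sum]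
  simp [inner_sum, sum_inner, inner_smul_left, inner_smul_right, hv, hv']

theorem one_sub_mul_pos_of_abs_lt_one_div {t l m : ℝ} (hm : m ≠ 0) (hl : |l| ≤ |m|)
    (ht : |t| < 1 / |m|) : 0 < 1 - t * l := by
  have h : |t| * |m| < 1 := (lt_div_iff₀ (abs_pos.2 hm)).1 ht
  have h' : |t| * |l| ≤ |t| * |m| := mul_le_mul_of_nonneg_left hl (abs_nonneg t)
  have := le_abs_self (t * l)
  rw [abs_mul] at this
  linarith

/-- Let `f₁, …, f_r` be orthonormal vectors orthogonal to `X₀`, let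
`x₁ ≠ 0`, let `λᵢ` be nonzero reals with `|λ₁| ≥ |λᵢ|`. With `X = X₀ + Σ xᵢ fᵢ` and
`Y(t) = X₀ + Σ (xᵢ/(1 − tλᵢ)) fᵢ` for `t ∈ (−1/|λ₁|, 1/|λ₁|)`: `⟪X, Y(t)⟫ > 0` on this
interval, and there exists `t₀` strictly between `0` and `1/λ₁` such that
`⟪Y(t₀), Y(t₀)⟫ = 2·⟪X, Y(t₀)⟫`, i.e. `F(Y(t₀)) = 2` for the Kropina function
`F y = ⟪y, y⟫ / ⟪X, y⟫`. -/
theorem kropina_intermediate_value_solution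
    {V : Type*} [NormedAddCommGroup V] [InnerProductSpace ℝ V] [FiniteDimensional ℝ V]
    (r : ℕ) (hr : 0 < r) (X₀ : V) (f : Fin r → V)
    (horth : Orthonormal ℝ f)
    (hX₀f : ∀ i : Fin r, ⟪X₀, f i⟫ = 0)
    (x : Fin r → ℝ) (hx1 : x ⟨0, hr⟩ ≠ 0)
    (lam : Fin r → ℝ) (hlam : ∀ i : Fin r, lam i ≠ 0)
    (hmax : ∀ i : Fin r, |lam i| ≤ |lam ⟨0, hr⟩|)
    (X : V) (hX : X = X₀ + ∑ i : Fin r, x i • f i)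
    (Y : ℝ → V) (hY : ∀ t : ℝ, Y t = X₀ + ∑ i : Fin r, (x i / (1 - t * lam i)) • f i)
    (F : V → ℝ) (hF : ∀ y : V, ⟪X, y⟫ ≠ 0 → F y = ⟪y, y⟫ / ⟪X, y⟫) :
    (∀ t ∈ Set.Ioo (-(1 / |lam ⟨0, hr⟩|)) (1 / |lam ⟨0, hr⟩|), 0 < ⟪X, Y t⟫) ∧
    ∃ t₀ ∈ Set.Ioo (min 0 (1 / lam ⟨0, hr⟩)) (max 0 (1 / lam ⟨0, hr⟩)),
      ⟪Y t₀, Y t₀⟫ = 2 * ⟪X, Y t₀⟫ ∧ F (Y t₀) = 2 := by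
  have hl := hlam ⟨0, hr⟩
  have hden (t : ℝ) (ht : |t| < 1 / |lam ⟨0, hr⟩|) (i : Fin r) : 0 < 1 - t * lam i :=
    one_sub_mul_pos_of_abs_lt_one_div hl (hmax i) ht
  have hXY (t : ℝ) : ⟪X, Y t⟫ = ⟪X₀, X₀⟫ + ∑ i, x i * (x i / (1 - t * lam i)) := by
    rw [hX, hY, horth.inner_add_sum_smul_add_sum_smul hX₀f]
  have hpos (t : ℝ) (ht : |t| < 1 / |lam ⟨0, hr⟩|) : 0 < ⟪X, Y t⟫ := by
    rw [hXY]
    refine add_pos_of_nonneg_of_pos real_inner_self_nonneg (Finset.sum_pos' (fun i _ ↦ ?_)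
      ⟨⟨0, hr⟩, Finset.mem_univ _, ?_⟩) <;> rw [← mul_div_assoc]
    · exact div_nonneg (mul_self_nonneg _) (hden t ht i).le
    · exact div_pos (mul_self_pos.2 hx1) (hden t ht _)
  refine ⟨fun t ht ↦ hpos t (abs_lt.2 ht), ?_⟩
  set C : ℝ := ⟪X₀, X₀⟫ + ∑ i, x i ^ 2 with hC
  have hCpos : 0 < C := add_pos_of_nonneg_of_pos real_inner_self_nonneg
    (Finset.sum_pos' (fun i _ ↦ sq_nonneg _) ⟨⟨0, hr⟩, Finset.mem_univ _, by positivity⟩)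
  have habs (s : ℝ) (h0 : 0 ≤ s) (h1 : s < 1) : |s / lam ⟨0, hr⟩| < 1 / |lam ⟨0, hr⟩| := by
    rw [abs_div, abs_of_nonneg h0]
    exact div_lt_div_of_pos_right h1 (abs_pos.2 hl)
  -- On the interval, `⟪Y t, Y t⟫ - 2 * ⟪X, Y t⟫ = g t - C`, with `g` blowing up at `1 / lam 0`.
  let g (t : ℝ) : ℝ := ∑ i, x i ^ 2 * (1 / (1 - t * lam i) - 1) ^ 2
  have hdiff (t : ℝ) : ⟪Y t, Y t⟫ - 2 * ⟪X, Y t⟫ = g t - C := by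
    rw [hXY, hY, horth.inner_add_sum_smul_add_sum_smul hX₀f, hC]
    have : ∑ i, x i / (1 - t * lam i) * (x i / (1 - t * lam i)) =
        g t + 2 * ∑ i, x i * (x i / (1 - t * lam i)) - ∑ i, x i ^ 2 := by
      simp only [g, Finset.mul_sum, ← Finset.sum_add_distrib, ← Finset.sum_sub_distrib]
      exact Finset.sum_congr rfl fun i _ ↦ by ring
    linarith
  let N : ℝ := 2 + C / x ⟨0, hr⟩ ^ 2
  have hN : 2 < N := lt_add_of_pos_right 2 (by positivity)
  have hNpos : 0 < N := by linarith
  have hNinv : N⁻¹ < 1 := inv_lt_one_of_one_lt₀ (by linarith)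
  have hNinv' : 0 < N⁻¹ := inv_pos.2 hNpos
  have hgN : C < g ((1 - N⁻¹) / lam ⟨0, hr⟩) := by
    have hterm : x ⟨0, hr⟩ ^ 2 * (N - 1) ^ 2 ≤ g ((1 - N⁻¹) / lam ⟨0, hr⟩) := by
      have := Finset.single_le_sum (s := Finset.univ)
        (f := fun i ↦ x i ^ 2 * (1 / (1 - (1 - N⁻¹) / lam ⟨0, hr⟩ * lam i) - 1) ^ 2)
        (fun i _ ↦ by positivity) (Finset.mem_univ ⟨0, hr⟩)
      simpa [g, div_mul_cancel₀ _ hl] using this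
    have hNC : x ⟨0, hr⟩ ^ 2 * (N - 1) = x ⟨0, hr⟩ ^ 2 + C := by
      simp only [N]
      field_simp
      ring
    have : 0 < x ⟨0, hr⟩ ^ 2 := by positivity
    nlinarith
  have hcont : ContinuousOn (fun s ↦ g (s / lam ⟨0, hr⟩)) (Set.Icc 0 (1 - N⁻¹)) := by
    refine continuousOn_finsetSum _ fun i _ ↦ ?_
    have hne : ∀ s ∈ Set.Icc 0 (1 - N⁻¹), 1 - s / lam ⟨0, hr⟩ * lam i ≠ 0 := fun s hs ↦
      (hden _ (habs s hs.1 (by linarith [hs.2])) i).ne'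
    fun_prop (disch := assumption)
  obtain ⟨s, hs, hgs⟩ := intermediate_value_Ioo (by linarith) hcont
    (show C ∈ Set.Ioo _ _ from ⟨by simpa [g] using hCpos, hgN⟩)
  have hs1 : s < 1 := by linarith [hs.2]
  have heq : ⟪Y (s / lam ⟨0, hr⟩), Y (s / lam ⟨0, hr⟩)⟫ = 2 * ⟪X, Y (s / lam ⟨0, hr⟩)⟫ := by
    have := hdiff (s / lam ⟨0, hr⟩)
    simp only at hgs
    linarith
  have hne := (hpos _ (habs s hs.1.le hs1)).ne'
  refine ⟨s / lam ⟨0, hr⟩, ?_, heq, by rw [hF _ hne, heq, mul_div_cancel_right₀ _ hne]⟩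
  rcases hl.lt_or_gt with h | h
  · rw [min_eq_right (one_div_neg.2 h).le, max_eq_left (one_div_neg.2 h).le]
    exact ⟨div_lt_div_of_neg_of_lt h hs1, div_neg_of_pos_of_neg hs.1 h⟩
  · rw [min_eq_left (one_div_pos.2 h).le, max_eq_right (one_div_pos.2 h).le]
    exact ⟨div_pos hs.1 h, div_lt_div_of_pos_right hs1 h⟩
end

section
/- Let Y ∈ 𝔤 with Y_𝔪 ≠ 0. If ⟨[Y,Z]_𝔪, Y_𝔪⟩ = 0 for all Z ∈ 𝔪 (Y is a geodesic vector of the Riemannian metric) and ⟨X, [Y,Z]_𝔪⟩ = 0 for all Z ∈ 𝔪, then g_{Y_𝔪}([Y,Z]_𝔪, Y_𝔪) = 0 for all Z ∈ 𝔪; that is, Y is a geodesic vector of the (α,β)-metric. -/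
open RealInnerProductSpace

section

variable {E : Type*} [NormedAddCommGroup E]

/-- The second derivative of a positively 2-homogeneous function at `p` in the directions `u`, `p`
equals its first derivative in the direction `u`. -/
theorem fderiv_fderiv_apply_self_of_homogeneous_two [NormedSpace ℝ E] {f : E → ℝ}
    (hf : ∀ z : E, z ≠ 0 → ContDiffAt ℝ 2 f z)
    (hom : ∀ z : E, z ≠ 0 → ∀ t : ℝ, 0 < t → f (t • z) = t ^ 2 * f z)
    {p : E} (hp : p ≠ 0) (u : E) :
    fderiv ℝ (fun z => fderiv ℝ f z) p u p = fderiv ℝ f p u := by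
  have hd : ∀ z : E, z ≠ 0 → DifferentiableAt ℝ f z :=
    fun z hz => (hf z hz).differentiableAt (by norm_num)
  have euler : ∀ z : E, z ≠ 0 → fderiv ℝ f z z = 2 * f z := by
    intro z hz
    have hline : HasDerivAt (fun t : ℝ => t • z) z 1 := by
      simpa using (hasDerivAt_id (1 : ℝ)).smul_const z
    have h1 : HasDerivAt (fun t : ℝ => f (t • z)) (fderiv ℝ f z z) 1 := by
      refine HasFDerivAt.comp_hasDerivAt (1 : ℝ) ?_ hline
      simpa using (hd z hz).hasFDerivAt
    have h2 : HasDerivAt (fun t : ℝ => t ^ 2 * f z) (2 * f z) 1 := by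
      simpa using (hasDerivAt_pow 2 (1 : ℝ)).mul_const (f z)
    refine h1.unique (h2.congr_of_eventuallyEq ?_)
    filter_upwards [lt_mem_nhds (zero_lt_one (α := ℝ))] with t ht using hom z hz t ht
  have hDf : DifferentiableAt ℝ (fun z => fderiv ℝ f z) p :=
    ((hf p hp).fderiv_right (m := 1) (by norm_num)).differentiableAt (by norm_num)
  have h1 := hDf.hasFDerivAt.clm_apply (hasFDerivAt_id p)
  have h2 : HasFDerivAt (fun z => 2 * f z) ((2 : ℝ) • fderiv ℝ f p) p :=
    (hd p hp).hasFDerivAt.const_mul 2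
  have h3 := h1.unique (h2.congr_of_eventuallyEq (by
    filter_upwards [isOpen_ne.mem_nhds hp] with z hz using euler z hz))
  have h4 := congrArg (fun L : E →L[ℝ] ℝ => L u) h3
  simp at h4
  linarith

/-- A function that is even along the line through `p` in direction `u` has vanishing derivative
at `p` in that direction. -/
theorem fderiv_apply_eq_zero_of_even_along [NormedSpace ℝ E] {f : E → ℝ} {p u : E}
    (hf : DifferentiableAt ℝ f p) (heven : ∀ t : ℝ, f (p + (-t) • u) = f (p + t • u)) :
    fderiv ℝ f p u = 0 := by
  have key : ∀ v : E, HasDerivAt (fun t : ℝ => f (p + t • v)) (fderiv ℝ f p v) 0 := by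
    intro v
    have hline : HasDerivAt (fun t : ℝ => p + t • v) v 0 := by
      simpa using ((hasDerivAt_id (0 : ℝ)).smul_const v).const_add p
    refine HasFDerivAt.comp_hasDerivAt (0 : ℝ) ?_ hline
    simpa using hf.hasFDerivAt
  have hneg := key (-u)
  have hcongr : (fun t : ℝ => f (p + t • -u)) = fun t : ℝ => f (p + t • u) := by
    funext t
    rw [← heven t, smul_neg, neg_smul]
  rw [hcongr] at hneg
  have h := hneg.unique (key u)
  rw [map_neg] at h
  linarith

theorem norm_add_neg_smul_eq_of_inner_eq_zero [InnerProductSpace ℝ E] {p u : E}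
    (h : ⟪u, p⟫ = 0) (t : ℝ) : ‖p + (-t) • u‖ = ‖p + t • u‖ := by
  rw [neg_smul, ← sub_eq_add_neg]
  refine norm_sub_eq_norm_add (𝕜 := ℝ) ?_
  rw [real_inner_smul_left, h, mul_zero]

end

/-- In the homogeneous (α,β)-metric setting (`F y = ‖y‖·φ(⟪X, y⟫/‖y‖)`,
`φ` smooth), if `Y ∈ 𝔤` with `Y_𝔪 ≠ 0` satisfies `⟪[Y,Z]_𝔪, Y_𝔪⟫ = 0` for all `Z ∈ 𝔪`
(geodesic vector of the Riemannian metric) and `⟪X, [Y,Z]_𝔪⟫ = 0` for all `Z ∈ 𝔪`,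
then `g_{Y_𝔪}([Y,Z]_𝔪, Y_𝔪) = 0` for all `Z ∈ 𝔪` (geodesic vector of the
(α,β)-metric). -/
theorem alpha_beta_geodesic_vector_of_riemannian
    {G : Type*} [NormedAddCommGroup G] [InnerProductSpace ℝ G] [FiniteDimensional ℝ G]
    (bracket : G →ₗ[ℝ] G →ₗ[ℝ] G)
    (hanti : ∀ x : G, bracket x x = 0)
    (hjacobi : ∀ x y z : G,
      bracket x (bracket y z) + bracket y (bracket z x) + bracket z (bracket x y) = 0)
    (H m : Submodule ℝ G)
    (hHsub : ∀ x ∈ H, ∀ y ∈ H, bracket x y ∈ H)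
    (hcompl : IsCompl m H)
    (π : G →ₗ[ℝ] G) (hπm : ∀ w : G, π w ∈ m) (hπH : ∀ w : G, w - π w ∈ H)
    (X : G) (hXm : X ∈ m)
    (φ : ℝ → ℝ) (hφ : ContDiff ℝ (⊤ : ℕ∞) φ)
    (F : G → ℝ) (hF : ∀ y : G, y ≠ 0 → F y = ‖y‖ * φ (⟪X, y⟫ / ‖y‖))
    (Y : G) (hYm : π Y ≠ 0)
    (hgeo : ∀ Z ∈ m, ⟪π (bracket Y Z), π Y⟫ = 0)
    (hDoug : ∀ Z ∈ m, ⟪X, π (bracket Y Z)⟫ = 0) :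
    ∀ Z ∈ m, (1 / 2 : ℝ) *
      fderiv ℝ (fun z => fderiv ℝ (fun w => F w ^ 2) z) (π Y) (π (bracket Y Z)) (π Y)
        = 0 := by
  intro Z hZ
  set p := π Y
  set u := π (bracket Y Z)
  have hup : ⟪u, p⟫ = 0 := hgeo Z hZ
  have hXu : ⟪X, u⟫ = 0 := hDoug Z hZ
  have hsmooth : ∀ z : G, z ≠ 0 → ContDiffAt ℝ 2 (fun w => F w ^ 2) z := by
    intro z hz
    have hnorm : ContDiffAt ℝ 2 (fun w : G => ‖w‖) z := contDiffAt_norm ℝ hz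
    have hquot : ContDiffAt ℝ 2 (fun w : G => ⟪X, w⟫ / ‖w‖) z :=
      (contDiffAt_const.inner ℝ contDiffAt_id).div hnorm (norm_ne_zero_iff.2 hz)
    have hφ2 : ContDiff ℝ 2 φ := contDiff_infty.1 hφ 2
    refine ((hnorm.mul (hφ2.contDiffAt.comp z hquot)).pow 2).congr_of_eventuallyEq ?_
    filter_upwards [isOpen_ne.mem_nhds hz] with w hw
    simp [hF w hw]
  have hom : ∀ z : G, z ≠ 0 → ∀ t : ℝ, 0 < t → F (t • z) ^ 2 = t ^ 2 * F z ^ 2 := by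
    intro z hz t ht
    rw [hF _ (smul_ne_zero ht.ne' hz), hF z hz, norm_smul, Real.norm_of_nonneg ht.le,
      inner_smul_right, mul_div_mul_left _ _ ht.ne']
    ring
  have hne : ∀ t : ℝ, p + t • u ≠ 0 := by
    intro t h
    have hpp : ⟪p + t • u, p⟫ = ⟪p, p⟫ := by
      rw [inner_add_left, real_inner_smul_left, hup, mul_zero, add_zero]
    rw [h, inner_zero_left] at hpp
    exact hYm (inner_self_eq_zero.1 hpp.symm)
  rw [fderiv_fderiv_apply_self_of_homogeneous_two hsmooth hom hYm u,
    fderiv_apply_eq_zero_of_even_along ((hsmooth p hYm).differentiableAt (by norm_num)), mul_zero]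
  intro t
  simp only [hF _ (hne _), norm_add_neg_smul_eq_of_inner_eq_zero hup, inner_add_right,
    inner_smul_right, hXu, mul_zero]
end

section
/- Assume ‖X‖ < 1 and ⟨X, [Y,Z]_𝔪⟩ = 0 for every Y ∈ 𝔤 and Z ∈ 𝔪. Then for every Y ∈ 𝔤 with Y_𝔪 ≠ 0, one has g_{Y_𝔪}([Y,Z]_𝔪, Y_𝔪) = 0 for all Z ∈ 𝔪 if and only if ⟨[Y,Z]_𝔪, Y_𝔪⟩ = 0 for all Z ∈ 𝔪. (A nonzero vector is a geodesic vector of a Randers metric of Douglas type if and only if it is a geodesic vector of the underlying Riemannian metric.) -/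
open RealInnerProductSpace

section Randers

variable {G : Type*} [NormedAddCommGroup G] [InnerProductSpace ℝ G]

/-- The first derivative of the square of a Randers function. -/
theorem hasFDerivAt_sq_of_randers {X : G} {F : G → ℝ}
    (hF : ∀ y : G, y ≠ 0 → F y = ‖y‖ + ⟪X, y⟫) {y : G} (hy : y ≠ 0) :
    HasFDerivAt (fun w => F w ^ 2)
      ((2 * F y) • (‖y‖⁻¹ • innerSL ℝ y + innerSL ℝ X)) y := by
  have hnorm : HasFDerivAt (fun w : G => ‖w‖) (‖y‖⁻¹ • innerSL ℝ y) y := by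
    have h := (hasStrictFDerivAt_norm_sq y).hasFDerivAt.sqrt
      (pow_ne_zero 2 (norm_ne_zero_iff.2 hy))
    simp only [Real.sqrt_sq (norm_nonneg _)] at h
    refine h.congr_fderiv ?_
    ext v
    simp
    field_simp
  have hR : HasFDerivAt F (‖y‖⁻¹ • innerSL ℝ y + innerSL ℝ X) y := by
    refine (hnorm.add (innerSL ℝ X).hasFDerivAt).congr_of_eventuallyEq ?_
    filter_upwards [isOpen_ne.mem_nhds hy] with w hw
    simpa using hF w hw
  refine (hR.pow 2).congr_fderiv ?_
  simp

/-- The fundamental tensor of a Randers function contracted with its base point is, by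
homogeneity, the first derivative. -/
theorem fderiv_fderiv_sq_apply_self_of_randers {X : G} {F : G → ℝ}
    (hF : ∀ y : G, y ≠ 0 → F y = ‖y‖ + ⟪X, y⟫) {y : G} (hy : y ≠ 0) (u : G) :
    fderiv ℝ (fun z => fderiv ℝ (fun w => F w ^ 2) z) y u y =
      2 * F y * (‖y‖⁻¹ * ⟪y, u⟫ + ⟪X, u⟫) := by
  have hev : ∀ᶠ w in nhds y, w ≠ 0 := isOpen_ne.mem_nhds hy
  have hsmooth : ContDiffAt ℝ 2 (fun w => F w ^ 2) y := by
    have h : ContDiffAt ℝ 2 (fun w : G => (‖w‖ + ⟪X, w⟫) ^ 2) y :=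
      ((contDiffAt_norm ℝ hy).add (contDiffAt_const.inner ℝ contDiffAt_id)).pow 2
    refine h.congr_of_eventuallyEq ?_
    filter_upwards [hev] with w hw
    rw [hF w hw]
  have hdiff : DifferentiableAt ℝ (fun z => fderiv ℝ (fun w => F w ^ 2) z) y :=
    (hsmooth.fderiv_right (m := 1) (by norm_num)).differentiableAt (by norm_num)
  have heuler : (fun z => fderiv ℝ (fun w => F w ^ 2) z z) =ᶠ[nhds y]
      fun z => 2 * F z ^ 2 := by
    filter_upwards [hev] with z hz
    rw [(hasFDerivAt_sq_of_randers hF hz).fderiv]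
    have hz' : ‖z‖ ≠ 0 := norm_ne_zero_iff.2 hz
    simp only [smul_apply, add_apply,
      innerSL_apply_apply, smul_eq_mul, real_inner_self_eq_norm_sq, hF z hz]
    field_simp
  have hleft := hdiff.hasFDerivAt.clm_apply (hasFDerivAt_id y)
  have hright := ((hasFDerivAt_sq_of_randers hF hy).const_mul 2).congr_of_eventuallyEq heuler
  have h := DFunLike.congr_fun (hleft.unique hright) u
  rw [(hasFDerivAt_sq_of_randers hF hy).fderiv] at h
  simp at h
  linarith

theorem randers_pos {X : G} (hX : ‖X‖ < 1) {y : G} (hy : y ≠ 0) : 0 < ‖y‖ + ⟪X, y⟫ := by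
  have h := abs_le.1 (abs_real_inner_le_norm X y)
  nlinarith [norm_pos_iff.2 hy]

end Randers

/-- In the homogeneous Randers setting (`F y = ‖y‖ + ⟪X, y⟫`, `‖X‖ < 1`),
assume the Douglas-type condition `⟪X, [Y,Z]_𝔪⟫ = 0` for every `Y ∈ 𝔤`, `Z ∈ 𝔪`. Then
for every `Y ∈ 𝔤` with `Y_𝔪 ≠ 0`, `g_{Y_𝔪}([Y,Z]_𝔪, Y_𝔪) = 0` for all `Z ∈ 𝔪` iff
`⟪[Y,Z]_𝔪, Y_𝔪⟫ = 0` for all `Z ∈ 𝔪`. -/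
theorem randers_douglas_geodesic_iff_riemannian
    {G : Type*} [NormedAddCommGroup G] [InnerProductSpace ℝ G] [FiniteDimensional ℝ G]
    (bracket : G →ₗ[ℝ] G →ₗ[ℝ] G)
    (hanti : ∀ x : G, bracket x x = 0)
    (hjacobi : ∀ x y z : G,
      bracket x (bracket y z) + bracket y (bracket z x) + bracket z (bracket x y) = 0)
    (H m : Submodule ℝ G)
    (hHsub : ∀ x ∈ H, ∀ y ∈ H, bracket x y ∈ H)
    (hcompl : IsCompl m H)
    (π : G →ₗ[ℝ] G) (hπm : ∀ w : G, π w ∈ m) (hπH : ∀ w : G, w - π w ∈ H)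
    (X : G) (hXm : X ∈ m) (hX : ‖X‖ < 1)
    (F : G → ℝ) (hF : ∀ y : G, y ≠ 0 → F y = ‖y‖ + ⟪X, y⟫)
    (hDouglas : ∀ (Y : G), ∀ Z ∈ m, ⟪X, π (bracket Y Z)⟫ = 0)
    (Y : G) (hYm : π Y ≠ 0) :
    (∀ Z ∈ m, (1 / 2 : ℝ) *
        fderiv ℝ (fun z => fderiv ℝ (fun w => F w ^ 2) z) (π Y) (π (bracket Y Z)) (π Y) = 0)
      ↔ (∀ Z ∈ m, ⟪π (bracket Y Z), π Y⟫ = 0) := by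
  have hpos : 0 < F (π Y) := hF _ hYm ▸ randers_pos hX hYm
  refine forall₂_congr fun Z hZ => ?_
  rw [fderiv_fderiv_sq_apply_self_of_randers hF hYm, hDouglas Y Z hZ, add_zero,
    real_inner_comm]
  simp [hpos.ne', hYm]
end
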